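/- (Theorem 1 of the paper.) Let Θ₁ and Θ₂ be measurable spaces, K₂ a Markov kernel from Θ₁ to Θ₂ (the approximate conditional π_{ε₂}(· | s₂(x*, θ₁))) and K₁ a Markov kernel from Θ₂ to Θ₁ (the approximate conditional π_{ε₁}(· | s₁(x*, θ₂))). Define the ABC-Gibbs transition map Q on probability measures on Θ₁ by Q ν = (ν.bind K₂).bind K₁. Assume there exists 0 < κ < 1/2 such that sup over θ₁, θ̃₁ ∈ Θ₁ of dTV(K₂ θ₁, K₂ θ̃₁) ≤ 2κ. Then Q admits a unique fixed point ν_ε among probability measures on Θ₁, and for every probability measure ν and every n ≥ 0, dTV(Qⁿ ν, ν_ε) ≤ (2κ)ⁿ · dTV(ν, ν_ε); that is, the θ₁-marginal chain of the two-component ABC-Gibbs sampler converges geometrically in total variation to ν_ε, with geometric rate 1 − 2κ in the paper's terminology. -/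

import Mathlib

open MeasureTheory ProbabilityTheory

/-- Total variation distance between two measures:
`dTV μ ν = sup over measurable sets A of |μ(A) − ν(A)|`. -/
noncomputable def dTV {X : Type*} [MeasurableSpace X] (μ ν : Measure X) : ℝ :=
  ⨆ A : {A : Set X // MeasurableSet A}, |(μ A.1).toReal - (ν A.1).toReal|

open Filter Topology

section TotalVariation

variable {X Y : Type*} [MeasurableSpace X] [MeasurableSpace Y]

lemma abs_real_sub_le_one (μ ν : Measure X) [IsProbabilityMeasure μ] [IsProbabilityMeasure ν]
    (A : Set X) : |(μ A).toReal - (ν A).toReal| ≤ 1 := by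
  have h1 : (μ A).toReal ≤ 1 := measureReal_le_one
  have h2 : (ν A).toReal ≤ 1 := measureReal_le_one
  have h3 : 0 ≤ (μ A).toReal := ENNReal.toReal_nonneg
  have h4 : 0 ≤ (ν A).toReal := ENNReal.toReal_nonneg
  rw [abs_le]
  constructor <;> linarith

lemma abs_real_sub_le_dTV (μ ν : Measure X) [IsProbabilityMeasure μ] [IsProbabilityMeasure ν]
    {A : Set X} (hA : MeasurableSet A) : |(μ A).toReal - (ν A).toReal| ≤ dTV μ ν := by
  have hb : BddAbove (Set.range fun A : {A : Set X // MeasurableSet A} =>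
      |(μ A.1).toReal - (ν A.1).toReal|) :=
    ⟨1, by rintro _ ⟨B, rfl⟩; exact abs_real_sub_le_one μ ν B.1⟩
  exact le_ciSup hb ⟨A, hA⟩

lemma dTV_le_of_forall {μ ν : Measure X} {c : ℝ}
    (h : ∀ A, MeasurableSet A → |(μ A).toReal - (ν A).toReal| ≤ c) : dTV μ ν ≤ c :=
  have : Nonempty {A : Set X // MeasurableSet A} := ⟨⟨∅, MeasurableSet.empty⟩⟩
  ciSup_le fun A => h A.1 A.2

lemma dTV_nonneg (μ ν : Measure X) : 0 ≤ dTV μ ν :=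
  Real.iSup_nonneg fun _ => abs_nonneg _

lemma dTV_le_one (μ ν : Measure X) [IsProbabilityMeasure μ] [IsProbabilityMeasure ν] :
    dTV μ ν ≤ 1 :=
  dTV_le_of_forall fun A _ => abs_real_sub_le_one μ ν A

lemma eq_of_dTV_le_zero {μ ν : Measure X} [IsProbabilityMeasure μ] [IsProbabilityMeasure ν]
    (h : dTV μ ν ≤ 0) : μ = ν := by
  ext A hA
  have h1 := (abs_real_sub_le_dTV μ ν hA).trans h
  rw [← ENNReal.toReal_eq_toReal_iff' (measure_ne_top _ _) (measure_ne_top _ _)]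
  exact sub_eq_zero.mp (abs_nonpos_iff.mp h1)

/-- Integrals of a function valued in `[0, c]` differ by at most `c` times the total variation
distance. -/
lemma abs_integral_sub_le_mul_dTV_of_mem_Icc (μ ν : Measure X) [IsProbabilityMeasure μ]
    [IsProbabilityMeasure ν] {f : X → ℝ} (hf : Measurable f) {c : ℝ} (hc : 0 ≤ c)
    (h0 : ∀ x, 0 ≤ f x) (h1 : ∀ x, f x ≤ c) :
    |∫ x, f x ∂μ - ∫ x, f x ∂ν| ≤ c * dTV μ ν := by
  have hint : ∀ (ρ : Measure X) [IsProbabilityMeasure ρ], Integrable f ρ := fun ρ _ =>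
    Integrable.of_bound hf.aestronglyMeasurable c
      (ae_of_all _ fun x => by rw [Real.norm_of_nonneg (h0 x)]; exact h1 x)
  have hlayer : ∀ (ρ : Measure X) [IsProbabilityMeasure ρ],
      ∫ x, f x ∂ρ = ∫ t in Set.Ioc 0 c, ρ.real {a | t ≤ f a} := fun ρ _ =>
    (hint ρ).integral_eq_integral_Ioc_meas_le (ae_of_all _ h0) (ae_of_all _ h1)
  have hlevel : ∀ (ρ : Measure X) [IsProbabilityMeasure ρ],
      IntegrableOn (fun t : ℝ => ρ.real {a | t ≤ f a}) (Set.Ioc 0 c) := fun ρ _ => by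
    have hanti : Antitone fun t : ℝ => ρ.real {a | t ≤ f a} := fun s t hst =>
      measureReal_mono fun a (ha : t ≤ f a) => hst.trans ha
    exact Integrable.of_bound hanti.measurable.aestronglyMeasurable 1
      (ae_of_all _ fun t => by
        rw [Real.norm_of_nonneg measureReal_nonneg]; exact measureReal_le_one)
  rw [hlayer μ, hlayer ν, ← integral_sub (hlevel μ) (hlevel ν), ← Real.norm_eq_abs]
  refine (norm_setIntegral_le_of_norm_le_const (C := dTV μ ν) (by simp) fun t _ =>
    abs_real_sub_le_dTV μ ν (hf measurableSet_Ici)).trans ?_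
  rw [Real.volume_real_Ioc_of_le hc, sub_zero, mul_comm]

/-- Integrals of a bounded function of oscillation at most `c` differ by at most `c` times the
total variation distance. -/
lemma abs_integral_sub_le_mul_dTV (μ ν : Measure X) [IsProbabilityMeasure μ]
    [IsProbabilityMeasure ν] {f : X → ℝ} (hf : Measurable f) {c : ℝ} (hosc : ∀ x y, f x - f y ≤ c) :
    |∫ x, f x ∂μ - ∫ x, f x ∂ν| ≤ c * dTV μ ν := by
  obtain ⟨x₀⟩ : Nonempty X := nonempty_of_isProbabilityMeasure μ
  have hc : 0 ≤ c := by simpa using hosc x₀ x₀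
  have hbdd : BddBelow (Set.range f) :=
    ⟨f x₀ - c, by rintro _ ⟨y, rfl⟩; linarith [hosc x₀ y]⟩
  have hint : ∀ (ρ : Measure X) [IsProbabilityMeasure ρ], Integrable f ρ := fun ρ _ =>
    Integrable.of_bound hf.aestronglyMeasurable (|f x₀| + c) (ae_of_all _ fun x => by
      rw [Real.norm_eq_abs, abs_le]
      constructor <;> linarith [hosc x x₀, hosc x₀ x, neg_abs_le (f x₀), le_abs_self (f x₀)])
  have : Nonempty X := ⟨x₀⟩
  have key := abs_integral_sub_le_mul_dTV_of_mem_Icc μ ν (f := fun x => f x - ⨅ y, f y)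
    (hf.sub_const _) hc (fun x => sub_nonneg.mpr (ciInf_le hbdd x))
    (fun x => by
      have : f x - c ≤ ⨅ y, f y := le_ciInf fun y => by linarith [hosc x y]
      linarith)
  rw [integral_sub (hint μ) (integrable_const _), integral_sub (hint ν) (integrable_const _)]
    at key
  simpa using key

lemma toReal_bind_apply (μ : Measure X) (K : Kernel X Y) [IsMarkovKernel K] {A : Set Y}
    (hA : MeasurableSet A) : ((μ.bind fun x => K x) A).toReal = ∫ x, (K x A).toReal ∂μ := by
  rw [Measure.bind_apply hA K.measurable.aemeasurable,
    integral_toReal (K.measurable_coe hA).aemeasurable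
      (ae_of_all _ fun x => measure_lt_top _ _)]

instance isProbabilityMeasure_bind_kernel (μ : Measure X) [IsProbabilityMeasure μ]
    (K : Kernel X Y) [IsMarkovKernel K] : IsProbabilityMeasure (μ.bind fun x => K x) :=
  isProbabilityMeasure_bind K.measurable.aemeasurable (ae_of_all _ fun _ => inferInstance)

/-- Dobrushin contraction. -/
lemma dTV_bind_le (μ ν : Measure X) [IsProbabilityMeasure μ] [IsProbabilityMeasure ν]
    (K : Kernel X Y) [IsMarkovKernel K] {c : ℝ} (hK : ∀ x y, dTV (K x) (K y) ≤ c) :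
    dTV (μ.bind fun x => K x) (ν.bind fun x => K x) ≤ c * dTV μ ν := by
  refine dTV_le_of_forall fun A hA => ?_
  rw [toReal_bind_apply μ K hA, toReal_bind_apply ν K hA]
  exact abs_integral_sub_le_mul_dTV μ ν (K.measurable_coe hA).ennreal_toReal fun x y =>
    ((le_abs_self _).trans (abs_real_sub_le_dTV (K x) (K y) hA)).trans (hK x y)

/-- A setwise limit, uniform over measurable sets, of probability measures is a probability
measure. -/
lemma exists_isProbabilityMeasure_of_tendstoUniformly (μ : ℕ → Measure X)
    [∀ n, IsProbabilityMeasure (μ n)] (m : Set X → ℝ) {b : ℕ → ℝ} (hb : Tendsto b atTop (𝓝 0))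
    (h : ∀ n A, MeasurableSet A → |(μ n A).toReal - m A| ≤ b n) :
    ∃ ρ : Measure X, IsProbabilityMeasure ρ ∧ ∀ A, MeasurableSet A → (ρ A).toReal = m A := by
  have hlim : ∀ A, MeasurableSet A → Tendsto (fun n => (μ n A).toReal) atTop (𝓝 (m A)) :=
    fun A hA => tendsto_iff_norm_sub_tendsto_zero.mpr
      (squeeze_zero (fun _ => norm_nonneg _) (fun n => h n A hA) hb)
  have hm_nonneg : ∀ A, MeasurableSet A → 0 ≤ m A := fun A hA =>
    ge_of_tendsto' (hlim A hA) fun _ => ENNReal.toReal_nonneg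
  have hm_empty : m ∅ = 0 :=
    tendsto_nhds_unique (hlim ∅ MeasurableSet.empty) (by simp)
  have hm_univ : m Set.univ = 1 :=
    tendsto_nhds_unique (hlim _ MeasurableSet.univ) (by simp)
  have hsum : ∀ f : ℕ → Set X, (∀ i, MeasurableSet (f i)) → Pairwise (Function.onFun Disjoint f) →
      HasSum (fun i => m (f i)) (m (⋃ i, f i)) := by
    intro f hf hd
    have hfin : ∀ n (s : Finset ℕ),
        (μ n (⋃ i ∈ s, f i)).toReal = ∑ i ∈ s, (μ n (f i)).toReal := fun n s =>
      measureReal_biUnion_finset (fun i _ j _ hij => hd hij) fun i _ => hf i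
    have hmfin : ∀ s : Finset ℕ, m (⋃ i ∈ s, f i) = ∑ i ∈ s, m (f i) := fun s => by
      refine tendsto_nhds_unique (hlim _ (s.measurableSet_biUnion fun i _ => hf i)) ?_
      simp_rw [hfin]
      exact tendsto_finsetSum s fun i _ => hlim _ (hf i)
    have hunif : TendstoUniformly (fun n (s : Finset ℕ) => ∑ i ∈ s, (μ n (f i)).toReal)
        (fun s => ∑ i ∈ s, m (f i)) atTop := by
      rw [Metric.tendstoUniformly_iff]
      intro ε hε
      filter_upwards [hb.eventually (gt_mem_nhds hε)] with n hn s
      rw [← hmfin, ← hfin, dist_comm, Real.dist_eq]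
      exact (h n _ (s.measurableSet_biUnion fun i _ => hf i)).trans_lt hn
    exact (hunif.tendstoUniformlyOnFilter.mono_right le_top).tendsto_of_eventually_tendsto
      (Eventually.of_forall fun n => by
        have := ENNReal.hasSum_toReal (f := fun i => μ n (f i)) (by
          rw [← measure_iUnion hd hf]; exact measure_ne_top _ _)
        rwa [← ENNReal.tsum_toReal_eq fun i => measure_ne_top _ _] at this)
      ((hlim _ (MeasurableSet.iUnion hf)).congr fun n => by
        rw [measure_iUnion hd hf, ENNReal.tsum_toReal_eq fun i => measure_ne_top _ _])
  let ρ : Measure X := Measure.ofMeasurable (fun A _ => ENNReal.ofReal (m A))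
    (by simp [hm_empty]) (fun f hf hd => by
      rw [← (hsum f hf hd).tsum_eq,
        ENNReal.ofReal_tsum_of_nonneg (fun i => hm_nonneg _ (hf i)) (hsum f hf hd).summable])
  have hρ : ∀ A, MeasurableSet A → ρ A = ENNReal.ofReal (m A) := fun A hA =>
    Measure.ofMeasurable_apply A hA
  refine ⟨ρ, ⟨by rw [hρ _ MeasurableSet.univ, hm_univ, ENNReal.ofReal_one]⟩, fun A hA => ?_⟩
  rw [hρ A hA, ENNReal.toReal_ofReal (hm_nonneg A hA)]

/-- Completeness of probability measures in total variation, along geometric sequences. -/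
lemma exists_dTV_le_of_le_geometric (μ : ℕ → Measure X) [∀ n, IsProbabilityMeasure (μ n)]
    {c : ℝ} (hc0 : 0 ≤ c) (hc1 : c < 1) (h : ∀ n, dTV (μ n) (μ (n + 1)) ≤ c ^ n) :
    ∃ ρ : Measure X, IsProbabilityMeasure ρ ∧ ∀ n, dTV (μ n) ρ ≤ c ^ n / (1 - c) := by
  have hstep : ∀ A, MeasurableSet A → ∀ n,
      dist (μ n A).toReal (μ (n + 1) A).toReal ≤ 1 * c ^ n := fun A hA n => by
    rw [one_mul, Real.dist_eq]
    exact (abs_real_sub_le_dTV _ _ hA).trans (h n)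
  have hex : ∀ A, MeasurableSet A → ∃ a, Tendsto (fun n => (μ n A).toReal) atTop (𝓝 a) :=
    fun A hA => cauchySeq_tendsto_of_complete (cauchySeq_of_le_geometric c 1 hc1 (hstep A hA))
  choose! m hm using hex
  have hbound : ∀ n A, MeasurableSet A → |(μ n A).toReal - m A| ≤ c ^ n / (1 - c) :=
    fun n A hA => by
      simpa [Real.dist_eq] using
        dist_le_of_le_geometric_of_tendsto c 1 hc1 (hstep A hA) (hm A hA) n
  have hb : Tendsto (fun n : ℕ => c ^ n / (1 - c)) atTop (𝓝 0) := by
    simpa using (tendsto_pow_atTop_nhds_zero_of_lt_one hc0 hc1).div_const (1 - c)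
  obtain ⟨ρ, hρ, hρm⟩ := exists_isProbabilityMeasure_of_tendstoUniformly μ m hb hbound
  exact ⟨ρ, hρ, fun n => dTV_le_of_forall fun A hA => by rw [hρm A hA]; exact hbound n A hA⟩

lemma dTV_triangle (μ ν ρ : Measure X) [IsProbabilityMeasure μ] [IsProbabilityMeasure ν]
    [IsProbabilityMeasure ρ] : dTV μ ρ ≤ dTV μ ν + dTV ν ρ :=
  dTV_le_of_forall fun _ hA => (abs_sub_le _ _ _).trans
    (add_le_add (abs_real_sub_le_dTV μ ν hA) (abs_real_sub_le_dTV ν ρ hA))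

lemma dTV_comm (μ ν : Measure X) : dTV μ ν = dTV ν μ := by
  simp only [dTV, abs_sub_comm]

lemma dTV_iterate_le {Q : Measure X → Measure X}
    (hprob : ∀ μ, IsProbabilityMeasure μ → IsProbabilityMeasure (Q μ)) {c : ℝ} (hc0 : 0 ≤ c)
    (hQ : ∀ μ ν, IsProbabilityMeasure μ → IsProbabilityMeasure ν →
      dTV (Q μ) (Q ν) ≤ c * dTV μ ν)
    (n : ℕ) (μ ν : Measure X) (hμ : IsProbabilityMeasure μ) (hν : IsProbabilityMeasure ν) :
    dTV (Q^[n] μ) (Q^[n] ν) ≤ c ^ n * dTV μ ν := by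
  induction n generalizing μ ν with
  | zero => simp
  | succ n ih =>
    rw [Function.iterate_succ_apply, Function.iterate_succ_apply, pow_succ, mul_assoc]
    exact (ih _ _ (hprob μ hμ) (hprob ν hν)).trans
      (mul_le_mul_of_nonneg_left (hQ μ ν hμ hν) (pow_nonneg hc0 n))

/-- Banach's fixed point theorem for probability measures in total variation. -/
lemma exists_fixedPoint_of_dTV_contraction [Nonempty X] {Q : Measure X → Measure X}
    (hprob : ∀ μ, IsProbabilityMeasure μ → IsProbabilityMeasure (Q μ)) {c : ℝ} (hc0 : 0 ≤ c)
    (hc1 : c < 1)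
    (hQ : ∀ μ ν, IsProbabilityMeasure μ → IsProbabilityMeasure ν →
      dTV (Q μ) (Q ν) ≤ c * dTV μ ν) :
    ∃ ρ : Measure X, IsProbabilityMeasure ρ ∧ Q ρ = ρ := by
  let δ : Measure X := Measure.dirac (Classical.arbitrary X)
  have hδ : IsProbabilityMeasure δ := Measure.dirac.isProbabilityMeasure
  have hiter : ∀ n, IsProbabilityMeasure (Q^[n] δ) := fun n => by
    induction n with
    | zero => exact hδ
    | succ n ih => rw [Function.iterate_succ_apply']; exact hprob _ ih
  have hQδ := hprob δ hδ
  obtain ⟨ρ, hρ, hle⟩ := exists_dTV_le_of_le_geometric (fun n => Q^[n] δ) hc0 hc1 fun n => by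
    rw [Function.iterate_succ_apply]
    exact (dTV_iterate_le hprob hc0 hQ n δ (Q δ) hδ hQδ).trans
      (mul_le_of_le_one_right (pow_nonneg hc0 n) (dTV_le_one _ _))
  refine ⟨ρ, hρ, ?_⟩
  have hQρ := hprob ρ hρ
  refine eq_of_dTV_le_zero ?_
  have hlim : Tendsto (fun n : ℕ => c * (c ^ n / (1 - c)) + c ^ (n + 1) / (1 - c)) atTop (𝓝 0) := by
    have h0 := (tendsto_pow_atTop_nhds_zero_of_lt_one hc0 hc1).div_const (1 - c)
    simpa using (h0.const_mul c).add (h0.comp (tendsto_add_atTop_nat 1))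
  refine ge_of_tendsto' hlim fun n => ?_
  have hn := hiter n
  have hn' := hiter (n + 1)
  refine (dTV_triangle _ (Q^[n + 1] δ) _).trans (add_le_add ?_ (hle (n + 1)))
  rw [dTV_comm, Function.iterate_succ_apply']
  exact (hQ _ _ hn hρ).trans (mul_le_mul_of_nonneg_left (hle n) hc0)

end TotalVariation

/-- Theorem 1 of the paper: if the approximate conditional kernel `K₂` of the
two-component ABC-Gibbs sampler satisfies `dTV (K₂ θ₁) (K₂ θ̃₁) ≤ 2κ` with
`0 < κ < 1/2`, then the θ₁-marginal transition map `Q ν = (ν.bind K₂).bind K₁`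
has a unique stationary probability measure `νε`, to which the chain converges
geometrically in total variation with rate `1 - 2κ`. -/
theorem stmt_3 {Θ₁ Θ₂ : Type*} [MeasurableSpace Θ₁] [MeasurableSpace Θ₂] [Nonempty Θ₁]
    (K₂ : Kernel Θ₁ Θ₂) [IsMarkovKernel K₂]
    (K₁ : Kernel Θ₂ Θ₁) [IsMarkovKernel K₁]
    (Q : Measure Θ₁ → Measure Θ₁)
    (hQ : ∀ ν : Measure Θ₁, Q ν = (ν.bind (fun t => K₂ t)).bind (fun t => K₁ t))
    (κ : ℝ) (hκ0 : 0 < κ) (hκhalf : κ < 1/2)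
    (hcontr : ∀ θ θ' : Θ₁, dTV (K₂ θ) (K₂ θ') ≤ 2 * κ) :
    ∃ νε : Measure Θ₁, IsProbabilityMeasure νε ∧ Q νε = νε ∧
      (∀ ν' : Measure Θ₁, IsProbabilityMeasure ν' → Q ν' = ν' → ν' = νε) ∧
      ∀ ν : Measure Θ₁, IsProbabilityMeasure ν → ∀ n : ℕ,
        dTV (Q^[n] ν) νε ≤ (2 * κ) ^ n * dTV ν νε := by
  have hc0 : 0 ≤ 2 * κ := by linarith
  have hc1 : 2 * κ < 1 := by linarith
  have hprob : ∀ μ, IsProbabilityMeasure μ → IsProbabilityMeasure (Q μ) := fun μ _ => by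
    rw [hQ]; infer_instance
  have hcontract : ∀ μ ν, IsProbabilityMeasure μ → IsProbabilityMeasure ν →
      dTV (Q μ) (Q ν) ≤ 2 * κ * dTV μ ν := fun μ ν _ _ => by
    rw [hQ, hQ]
    calc _ ≤ 1 * dTV (μ.bind fun t => K₂ t) (ν.bind fun t => K₂ t) :=
          dTV_bind_le _ _ K₁ fun _ _ => dTV_le_one _ _
      _ ≤ 2 * κ * dTV μ ν := by
          rw [one_mul]
          exact dTV_bind_le μ ν K₂ hcontr
  obtain ⟨νε, hνε, hfix⟩ := exists_fixedPoint_of_dTV_contraction hprob hc0 hc1 hcontract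
  refine ⟨νε, hνε, hfix, fun ν' hν' hfix' => eq_of_dTV_le_zero ?_, fun ν hν n => ?_⟩
  · have h := hcontract ν' νε hν' hνε
    rw [hfix, hfix'] at h
    nlinarith
  · have h := dTV_iterate_le hprob hc0 hcontract n ν νε hν hνε
    rwa [Function.iterate_fixed hfix] at h
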